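/- Fix a > 2 and set N_n = 2^{2^n}. Define E_n = {φ ∈ (−π, π] : cos(N_n φ) > 1 − n^{−a}}, E_{n,m} = {φ ∈ (−π, π] : cos(N_n φ) > 1 − N_m^{−1}}, F_m = (∪_{n≥m} E_n) ∪ (∪_{1≤n<m} E_{n,m}), and F = ∩_{m≥1} F_m. Let u(z) = Re ∑_{n≥1} 2^n z^{2^{2^n}} / (z^{2^{2^n}} − 1) on the open unit disk 𝔻. Then for every φ ∈ (−π, π] with φ ∉ F, liminf_{R→1⁻} I_u(R,φ) / log log(1/(1−R)) > 0. -/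

import Mathlib

open MeasureTheory Real Filter Set Metric

/-- The weighted radial average `I_u(R,φ)`. -/
noncomputable def Iu (u : ℂ → ℝ) (R φ : ℝ) : ℝ :=
  ∫ r in (1/2 : ℝ)..R, u ((r : ℂ) * Complex.exp (Complex.I * φ)) /
    ((1 - r) * (Real.log (1 / (1 - r))) ^ 2)

/-- `N_n = 2^(2^n)` as a real number. -/
noncomputable def Nn (n : ℕ) : ℝ := (2 : ℝ) ^ (2 ^ n)

/-- `E_n = {φ ∈ (−π, π] : cos(N_n φ) > 1 − n^(−a)}`. -/
noncomputable def En (a : ℝ) (n : ℕ) : Set ℝ :=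
  {φ ∈ Ioc (-π) π | 1 - (n : ℝ) ^ (-a) < Real.cos (Nn n * φ)}

/-- `E_{n,m} = {φ ∈ (−π, π] : cos(N_n φ) > 1 − N_m⁻¹}`. -/
noncomputable def Enm (n m : ℕ) : Set ℝ :=
  {φ ∈ Ioc (-π) π | 1 - (Nn m)⁻¹ < Real.cos (Nn n * φ)}

/-- `F_m = (∪_{n ≥ m} E_n) ∪ (∪_{1 ≤ n < m} E_{n,m})`. -/
noncomputable def Fm (a : ℝ) (m : ℕ) : Set ℝ :=
  (⋃ n, ⋃ (_ : m ≤ n), En a n) ∪ (⋃ n, ⋃ (_ : 1 ≤ n ∧ n < m), Enm n m)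

/-- `F = ∩_{m ≥ 1} F_m`. -/
noncomputable def Fbad (a : ℝ) : Set ℝ :=
  ⋂ m, ⋂ (_ : 1 ≤ m), Fm a m

/-- The function `u(z) = Re ∑_{n≥1} 2ⁿ z^(2^(2ⁿ)) / (z^(2^(2ⁿ)) − 1)`. -/
noncomputable def uNonOsc (z : ℂ) : ℝ :=
  (∑' n : ℕ, (2 : ℂ) ^ (n + 1) * z ^ (2 ^ (2 ^ (n + 1))) /
    (z ^ (2 ^ (2 ^ (n + 1))) - 1)).re

/-- The real part of `w / (w - 1)` at `w = (r e^{iφ})^N`. -/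
noncomputable def reTerm (N : ℕ) (φ r : ℝ) : ℝ :=
  (((r : ℂ) * Complex.exp (Complex.I * φ)) ^ N /
    (((r : ℂ) * Complex.exp (Complex.I * φ)) ^ N - 1)).re

lemma norm_polar_pow (N : ℕ) (φ : ℝ) {r : ℝ} (hr : 0 ≤ r) :
    ‖((r : ℂ) * Complex.exp (Complex.I * φ)) ^ N‖ = r ^ N := by
  rw [norm_pow, norm_mul, mul_comm Complex.I, Complex.norm_exp_ofReal_mul_I]
  simp [abs_of_nonneg hr]

lemma re_polar_pow (N : ℕ) (φ r : ℝ) :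
    (((r : ℂ) * Complex.exp (Complex.I * φ)) ^ N).re = r ^ N * Real.cos (N * φ) := by
  rw [mul_pow, ← Complex.exp_nat_mul]
  have : (N : ℂ) * (Complex.I * φ) = ((N * φ : ℝ) : ℂ) * Complex.I := by push_cast; ring
  rw [this, ← Complex.ofReal_pow, Complex.re_ofReal_mul, Complex.exp_ofReal_mul_I_re]

lemma le_normSq_sub_one {w : ℂ} {δ : ℝ} (hδ : 0 ≤ δ) (hδ1 : δ ≤ 1)
    (hre : w.re ≤ ‖w‖ * (1 - δ)) : δ ≤ Complex.normSq (w - 1) := by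
  have h1 : Complex.normSq w = ‖w‖ ^ 2 := Complex.normSq_eq_norm_sq w
  have h2 : Complex.normSq (w - 1) = ‖w‖ ^ 2 - 2 * w.re + 1 := by
    rw [← h1]; simp [Complex.normSq_apply]; ring
  rw [h2]
  nlinarith [mul_nonneg (sub_nonneg.2 hδ1) (sq_nonneg (1 - ‖w‖)),
    mul_nonneg hδ (sq_nonneg ‖w‖)]

lemma abs_re_div_sub_one_le {w : ℂ} {δ : ℝ} (hδ : 0 < δ) (hδ1 : δ ≤ 1)
    (hre : w.re ≤ ‖w‖ * (1 - δ)) : |(w / (w - 1)).re| ≤ ‖w‖ / δ := by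
  have h := le_normSq_sub_one hδ.le hδ1 hre
  rw [Complex.normSq_eq_norm_sq] at h
  refine (Complex.abs_re_le_norm _).trans ?_
  rw [norm_div]
  have h3 : δ ≤ ‖w - 1‖ := by
    by_contra hc
    push Not at hc
    nlinarith [norm_nonneg (w - 1)]
  gcongr

lemma abs_re_div_sub_one_sub_half_le {w : ℂ} {δ : ℝ} (hw : ‖w‖ < 1) (hδ : 0 < δ) (hδ1 : δ ≤ 1)
    (hre : w.re ≤ ‖w‖ * (1 - δ)) : |(w / (w - 1)).re - 1 / 2| ≤ (1 - ‖w‖) / δ := by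
  have h := le_normSq_sub_one hδ.le hδ1 hre
  have h1 : Complex.normSq w = ‖w‖ ^ 2 := Complex.normSq_eq_norm_sq w
  have h0 : 0 < Complex.normSq (w - 1) := hδ.trans_le h
  have h2 : (w / (w - 1)).re - 1 / 2 = -((1 - ‖w‖ ^ 2) / (2 * Complex.normSq (w - 1))) := by
    rw [← h1, Complex.div_re]
    field_simp
    simp [Complex.normSq_apply]; ring
  have h4 : 0 ≤ 1 - ‖w‖ ^ 2 := by nlinarith [norm_nonneg w]
  rw [h2, abs_neg, abs_of_nonneg (by positivity), div_le_div_iff₀ (by positivity) hδ]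
  have h5 : 1 - ‖w‖ ^ 2 ≤ 2 * (1 - ‖w‖) := by nlinarith [norm_nonneg w]
  nlinarith [mul_le_mul h5 h hδ.le (by linarith)]

lemma abs_reTerm_le {N : ℕ} {φ δ r : ℝ} (hδ : 0 < δ) (hδ1 : δ ≤ 1)
    (hcos : Real.cos (N * φ) ≤ 1 - δ) (hr : 0 ≤ r) : |reTerm N φ r| ≤ r ^ N / δ := by
  have h := abs_re_div_sub_one_le (w := ((r : ℂ) * Complex.exp (Complex.I * φ)) ^ N) hδ hδ1
  rw [norm_polar_pow N φ hr, re_polar_pow] at h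
  exact h (by gcongr)

lemma abs_reTerm_sub_half_le {N : ℕ} {φ δ r : ℝ} (hN : N ≠ 0) (hδ : 0 < δ) (hδ1 : δ ≤ 1)
    (hcos : Real.cos (N * φ) ≤ 1 - δ) (hr : 0 ≤ r) (hr1 : r < 1) :
    |reTerm N φ r - 1 / 2| ≤ (1 - r ^ N) / δ := by
  have h := abs_re_div_sub_one_sub_half_le
    (w := ((r : ℂ) * Complex.exp (Complex.I * φ)) ^ N) (δ := δ)
  rw [norm_polar_pow N φ hr, re_polar_pow] at h
  exact h (pow_lt_one₀ hr hr1 hN) hδ hδ1 (by gcongr)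

lemma exp_neg_abs_mul_sq_le {x q : ℝ} (hx : 1 / 2 ≤ x) (hq : 0 < q) :
    Real.exp (-|x - q|) / x ^ 2 ≤ 1024 / q ^ 2 * (1 / (1 + (x - q) ^ 2)) := by
  set d := |x - q| with hd
  have hd0 : 0 ≤ d := abs_nonneg _
  have hqx : q ≤ x * (1 + 2 * d) := by
    have : q - x ≤ d := by rw [hd, abs_sub_comm]; exact le_abs_self _
    nlinarith
  have he : (1 + d / 4) ^ 4 ≤ Real.exp d := by
    have h1 : 1 + d / 4 ≤ Real.exp (d / 4) := by linarith [Real.add_one_le_exp (d / 4)]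
    calc (1 + d / 4) ^ 4 ≤ Real.exp (d / 4) ^ 4 := by gcongr
      _ = Real.exp d := by rw [← Real.exp_nat_mul]; congr 1; push_cast; ring
  have hpoly : (1 + 2 * d) ^ 2 * (1 + d ^ 2) ≤ 1024 * (1 + d / 4) ^ 4 := by
    have e1 : (1 + 2 * d) ^ 2 ≤ 64 * (1 + d / 4) ^ 2 := by nlinarith
    have e2 : 1 + d ^ 2 ≤ 16 * (1 + d / 4) ^ 2 := by nlinarith
    calc _ ≤ (64 * (1 + d / 4) ^ 2) * (16 * (1 + d / 4) ^ 2) := by gcongr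
      _ = _ := by ring
  have hq2 : q ^ 2 ≤ x ^ 2 * (1 + 2 * d) ^ 2 := by
    rw [← mul_pow]; gcongr
  have hmain : q ^ 2 * (1 + d ^ 2) ≤ 1024 * (x ^ 2 * Real.exp d) := by
    calc q ^ 2 * (1 + d ^ 2) ≤ x ^ 2 * (1 + 2 * d) ^ 2 * (1 + d ^ 2) := by gcongr
      _ = x ^ 2 * ((1 + 2 * d) ^ 2 * (1 + d ^ 2)) := by ring
      _ ≤ x ^ 2 * (1024 * Real.exp d) :=
        mul_le_mul_of_nonneg_left (by linarith) (sq_nonneg x)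
      _ = _ := by ring
  have hx0 : 0 < x := by linarith
  rw [← sq_abs (x - q), ← hd, Real.exp_neg, div_mul_div_comm, inv_eq_one_div, div_div,
    div_le_div_iff₀ (by positivity) (by positivity)]
  linarith

lemma pow_le_exp_neg {N : ℕ} {r : ℝ} (hN : 0 < N) (hr : 0 ≤ r) (hr1 : r < 1) :
    r ^ N ≤ Real.exp (Real.log (1 / (1 - r)) - Real.log N) := by
  have ht : 0 < 1 - r := by linarith
  have hN' : (0 : ℝ) < N := by exact_mod_cast hN
  have hs : 0 < N * (1 - r) := by positivity
  rw [Real.exp_sub, Real.exp_log (by positivity), Real.exp_log hN', div_div, mul_comm]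
  have h1 : r ≤ Real.exp (-(1 - r)) := by linarith [Real.add_one_le_exp (-(1 - r))]
  calc r ^ N ≤ Real.exp (-(1 - r)) ^ N := by gcongr
    _ = (Real.exp (N * (1 - r)))⁻¹ := by rw [← Real.exp_nat_mul, ← Real.exp_neg]; congr 1; ring
    _ ≤ (N * (1 - r))⁻¹ := by
      gcongr; linarith [Real.add_one_le_exp (N * (1 - r))]
    _ = _ := by rw [one_div]

lemma one_sub_pow_le_exp {N : ℕ} {r : ℝ} (hN : 0 < N) (hr : 0 ≤ r) (hr1 : r < 1) :
    1 - r ^ N ≤ Real.exp (Real.log N - Real.log (1 / (1 - r))) := by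
  have ht : 0 < 1 - r := by linarith
  have hN' : (0 : ℝ) < N := by exact_mod_cast hN
  rw [Real.exp_sub, Real.exp_log hN', Real.exp_log (by positivity)]
  have := one_add_mul_le_pow (a := r - 1) (by linarith) N
  simp only [add_sub_cancel] at this
  rw [div_div_eq_mul_div, div_one]
  linarith

lemma half_le_log_inv {r : ℝ} (hr : 1 / 2 ≤ r) (hr1 : r < 1) :
    1 / 2 ≤ Real.log (1 / (1 - r)) := by
  have h2 : (2 : ℝ) ≤ 1 / (1 - r) := by
    rw [le_div_iff₀ (by linarith)]; linarith
  have := Real.log_le_log (by norm_num) h2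
  linarith [Real.log_two_gt_d9]

lemma hasDerivAt_log_inv {r : ℝ} (hr1 : r < 1) :
    HasDerivAt (fun s : ℝ => Real.log (1 / (1 - s))) (1 / (1 - r)) r := by
  have ht : 1 - r ≠ 0 := by linarith
  have h : HasDerivAt (fun s : ℝ => -Real.log (1 - s)) (-(-1 / (1 - r))) r :=
    (((hasDerivAt_id r).const_sub 1).log ht).neg
  have e : (fun s : ℝ => Real.log (1 / (1 - s))) = fun s => -Real.log (1 - s) := by
    ext s; rw [one_div, Real.log_inv]
  rw [e]
  convert h using 1
  ring

lemma continuousOn_log_inv {α β : ℝ} (hβ : β < 1) :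
    ContinuousOn (fun s : ℝ => Real.log (1 / (1 - s))) (Icc α β) := fun _ hr =>
  (hasDerivAt_log_inv (hr.2.trans_lt hβ)).continuousAt.continuousWithinAt

lemma integral_weight {α β : ℝ} (hα : 1 / 2 ≤ α) (hαβ : α ≤ β) (hβ : β < 1) :
    ∫ r in α..β, (1 / 2) / ((1 - r) * (Real.log (1 / (1 - r))) ^ 2) =
      1 / 2 * (1 / Real.log (1 / (1 - α)) - 1 / Real.log (1 / (1 - β))) := by
  have hL := continuousOn_log_inv (α := α) hβ
  have hpos : ∀ r ∈ Icc α β, 0 < (1 - r) * (Real.log (1 / (1 - r))) ^ 2 := fun r hr => by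
    have := half_le_log_inv (hα.trans hr.1) (hr.2.trans_lt hβ)
    have : 0 < 1 - r := by linarith [hr.2]
    positivity
  rw [intervalIntegral.integral_eq_sub_of_hasDerivAt
    (f := fun r => -(1 / 2) * (Real.log (1 / (1 - r)))⁻¹)]
  · ring
  · intro r hr
    rw [uIcc_of_le hαβ] at hr
    have h1 := half_le_log_inv (hα.trans hr.1) (hr.2.trans_lt hβ)
    have h2 := ((hasDerivAt_log_inv (hr.2.trans_lt hβ)).inv (by linarith)).const_mul (-(1 / 2 : ℝ))
    have h3 : 1 - r ≠ 0 := by linarith [hr.2]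
    exact h2.congr_deriv (by field_simp)
  · apply ContinuousOn.intervalIntegrable
    rw [uIcc_of_le hαβ]
    exact continuousOn_const.div ((continuousOn_const.sub continuousOn_id).mul (hL.pow 2))
      fun r hr => (hpos r hr).ne'

lemma abs_integral_le_of_exp_decay {f : ℝ → ℝ} {α β q δ : ℝ} (hα : 1 / 2 ≤ α) (hαβ : α ≤ β)
    (hβ : β < 1) (hq : 0 < q) (hδ : 0 < δ)
    (hf : ∀ r ∈ Icc α β, |f r| ≤ Real.exp (-|Real.log (1 / (1 - r)) - q|) / δ) :
    |∫ r in α..β, f r / ((1 - r) * (Real.log (1 / (1 - r))) ^ 2)| ≤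
      1024 * π / (δ * q ^ 2) := by
  have hL := continuousOn_log_inv (α := α) hβ
  set g : ℝ → ℝ := fun r => 1 / (1 + (Real.log (1 / (1 - r)) - q) ^ 2) * (1 / (1 - r)) with hg
  have hgc : IntervalIntegrable g volume α β := by
    apply ContinuousOn.intervalIntegrable
    rw [uIcc_of_le hαβ]
    refine ContinuousOn.mul (continuousOn_const.div
      (continuousOn_const.add ((hL.sub continuousOn_const).pow 2)) fun _ _ => ?_)
      (continuousOn_const.div (continuousOn_const.sub continuousOn_id) fun r hr => ?_)
    · positivity
    · have := hr.2; linarith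
  have hgi : ∫ r in α..β, g r = Real.arctan (Real.log (1 / (1 - β)) - q) -
      Real.arctan (Real.log (1 / (1 - α)) - q) := by
    refine intervalIntegral.integral_eq_sub_of_hasDerivAt
      (f := fun r => Real.arctan (Real.log (1 / (1 - r)) - q)) (fun r hr => ?_) hgc
    rw [uIcc_of_le hαβ] at hr
    exact ((hasDerivAt_log_inv (hr.2.trans_lt hβ)).sub_const q).arctan
  have hb : |∫ r in α..β, f r / ((1 - r) * (Real.log (1 / (1 - r))) ^ 2)| ≤
      ∫ r in α..β, 1024 / (δ * q ^ 2) * g r := by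
    rw [← Real.norm_eq_abs]
    refine intervalIntegral.norm_integral_le_of_norm_le hαβ
      (Eventually.of_forall fun r hr => ?_) (hgc.const_mul _)
    have hr' : r ∈ Icc α β := Ioc_subset_Icc_self hr
    have h1 := half_le_log_inv (hα.trans hr'.1) (hr'.2.trans_lt hβ)
    have h2 : 0 < 1 - r := by linarith [hr'.2]
    set x := Real.log (1 / (1 - r)) with hx
    rw [Real.norm_eq_abs, abs_div, abs_of_pos (a := (1 - r) * x ^ 2) (by positivity)]
    calc |f r| / ((1 - r) * x ^ 2) ≤ Real.exp (-|x - q|) / δ / ((1 - r) * x ^ 2) := by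
          gcongr; exact hf r hr'
      _ = Real.exp (-|x - q|) / x ^ 2 * (1 / (δ * (1 - r))) := by field_simp
      _ ≤ 1024 / q ^ 2 * (1 / (1 + (x - q) ^ 2)) * (1 / (δ * (1 - r))) := by
          gcongr; exact exp_neg_abs_mul_sq_le h1 hq
      _ = _ := by simp only [hg, ← hx]; field_simp
  rw [intervalIntegral.integral_const_mul, hgi] at hb
  refine hb.trans ?_
  have := Real.arctan_lt_pi_div_two (Real.log (1 / (1 - β)) - q)
  have := Real.neg_pi_div_two_lt_arctan (Real.log (1 / (1 - α)) - q)
  calc _ ≤ 1024 / (δ * q ^ 2) * π := by gcongr; linarith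
    _ = _ := by ring

lemma polar_pow_sub_one_ne_zero {N : ℕ} (hN : N ≠ 0) (φ : ℝ) {r : ℝ} (hr : 0 ≤ r) (hr1 : r < 1) :
    ((r : ℂ) * Complex.exp (Complex.I * φ)) ^ N - 1 ≠ 0 := by
  intro h
  have h1 := norm_polar_pow N φ hr
  rw [sub_eq_zero.1 h, norm_one] at h1
  exact (pow_lt_one₀ hr hr1 hN).ne h1.symm

lemma continuousOn_reTerm {N : ℕ} (hN : N ≠ 0) (φ : ℝ) {α β : ℝ} (hα : 0 ≤ α) (hβ : β < 1) :
    ContinuousOn (reTerm N φ) (Icc α β) := by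
  unfold reTerm
  refine Complex.continuous_re.comp_continuousOn (ContinuousOn.div ?_ ?_ fun r hr =>
    polar_pow_sub_one_ne_zero hN φ (hα.trans hr.1) (hr.2.trans_lt hβ))
  all_goals fun_prop

lemma continuousOn_div_weight {f : ℝ → ℝ} {α β : ℝ} (hα : 1 / 2 ≤ α) (hβ : β < 1)
    (hf : ContinuousOn f (Icc α β)) :
    ContinuousOn (fun r => f r / ((1 - r) * (Real.log (1 / (1 - r))) ^ 2)) (Icc α β) := by
  refine hf.div ((continuousOn_const.sub continuousOn_id).mul
    ((continuousOn_log_inv hβ).pow 2)) fun r hr => ?_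
  have h1 := half_le_log_inv (hα.trans hr.1) (hr.2.trans_lt hβ)
  have h2 : 0 < 1 - r := by linarith [hr.2]
  positivity

lemma intervalIntegrable_div_weight {f : ℝ → ℝ} {α β : ℝ} (hα : 1 / 2 ≤ α) (hαβ : α ≤ β)
    (hβ : β < 1) (hf : ContinuousOn f (Icc α β)) :
    IntervalIntegrable (fun r => f r / ((1 - r) * (Real.log (1 / (1 - r))) ^ 2)) volume α β := by
  apply ContinuousOn.intervalIntegrable
  rw [uIcc_of_le hαβ]
  exact continuousOn_div_weight hα hβ hf

lemma abs_integral_reTerm_sub_le {N : ℕ} {φ δ R : ℝ} (hN : 2 ≤ N) (hδ : 0 < δ) (hδ1 : δ ≤ 1)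
    (hcos : Real.cos (N * φ) ≤ 1 - δ) (hR : 1 / 2 ≤ R) (hR1 : R < 1) :
    |(∫ r in (1 / 2 : ℝ)..R, reTerm N φ r / ((1 - r) * (Real.log (1 / (1 - r))) ^ 2)) -
      max 0 (1 / 2 * (1 / Real.log N - 1 / Real.log (1 / (1 - R))))| ≤
      2048 * π / (δ * Real.log N ^ 2) := by
  have hN0 : 0 < N := by omega
  have hNR : (2 : ℝ) ≤ N := by exact_mod_cast hN
  have hq : 0 < Real.log N := Real.log_pos (by linarith)
  have hC : 2048 * π / (δ * Real.log N ^ 2) = 1024 * π / (δ * Real.log N ^ 2) +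
    1024 * π / (δ * Real.log N ^ 2) := by ring
  have hC0 : 0 ≤ 1024 * π / (δ * Real.log N ^ 2) := by positivity
  set ρ : ℝ := 1 - 1 / N with hρ
  have hρ1 : ρ < 1 := by
    have : (0 : ℝ) < 1 / N := by positivity
    linarith
  have hρ2 : 1 / 2 ≤ ρ := by
    have : (1 : ℝ) / N ≤ 1 / 2 := by gcongr
    linarith
  have hLρ : Real.log (1 / (1 - ρ)) = Real.log N := by
    rw [hρ]; congr 1; rw [sub_sub_cancel, one_div_one_div]
  have hmono : ∀ {s t : ℝ}, s ≤ t → t < 1 →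
      Real.log (1 / (1 - s)) ≤ Real.log (1 / (1 - t)) := fun {s t} hst ht => by
    have : 0 < 1 - s := by linarith
    have : 0 < 1 - t := by linarith
    gcongr
  have hlow : ∀ β, 1 / 2 ≤ β → β ≤ ρ →
      |∫ r in (1 / 2 : ℝ)..β, reTerm N φ r / ((1 - r) * (Real.log (1 / (1 - r))) ^ 2)| ≤
      1024 * π / (δ * Real.log N ^ 2) := by
    intro β hβ hβρ
    refine abs_integral_le_of_exp_decay le_rfl hβ (by linarith) hq hδ fun r hr => ?_
    have hr1 : r < 1 := by linarith [hr.2]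
    have hr0 : 0 ≤ r := by linarith [hr.1]
    refine (abs_reTerm_le hδ hδ1 hcos hr0).trans ?_
    have := hmono (hr.2.trans hβρ) hρ1
    rw [abs_of_nonpos (by linarith), neg_neg]
    gcongr
    exact pow_le_exp_neg hN0 hr0 hr1
  rcases le_total R ρ with h | h
  · have h1 := hmono h hρ1
    rw [hLρ] at h1
    have h2 : 0 < Real.log (1 / (1 - R)) := by linarith [half_le_log_inv hR hR1]
    have h3 : 1 / Real.log N ≤ 1 / Real.log (1 / (1 - R)) := by gcongr
    rw [max_eq_left (by linarith), sub_zero]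
    linarith [hlow R hR h]
  · have h1 := hmono h hR1
    rw [hLρ] at h1
    have h3 : 1 / Real.log (1 / (1 - R)) ≤ 1 / Real.log N := by gcongr
    rw [max_eq_right (by linarith)]
    have hc1 := intervalIntegrable_div_weight le_rfl hρ2 hρ1
      (continuousOn_reTerm hN0.ne' φ (by norm_num) hρ1)
    have hc2 := intervalIntegrable_div_weight hρ2 h hR1
      (continuousOn_reTerm hN0.ne' φ (by linarith) hR1)
    have hc3 := intervalIntegrable_div_weight hρ2 h hR1
      (continuousOn_const (c := (1 / 2 : ℝ)))
    have hw := integral_weight hρ2 h hR1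
    rw [hLρ] at hw
    rw [← hw, ← intervalIntegral.integral_add_adjacent_intervals hc1 hc2, add_sub_assoc,
      ← intervalIntegral.integral_sub hc2 hc3, hC]
    refine (abs_add_le _ _).trans (add_le_add (hlow ρ hρ2 le_rfl) ?_)
    simp_rw [← sub_div]
    refine abs_integral_le_of_exp_decay hρ2 h hR1 hq hδ fun r hr => ?_
    have hr1 : r < 1 := by linarith [hr.2]
    have hr0 : 0 ≤ r := by linarith [hr.1]
    refine (abs_reTerm_sub_half_le hN0.ne' hδ hδ1 hcos hr0 hr1).trans ?_
    have := hmono hr.1 hr1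
    rw [hLρ] at this
    rw [abs_of_nonneg (by linarith), neg_sub]
    gcongr
    exact one_sub_pow_le_exp hN0 hr0 hr1

lemma norm_div_sub_one_le {N : ℕ} (hN : N ≠ 0) (φ : ℝ) {r R : ℝ} (hr : 0 ≤ r) (hrR : r ≤ R)
    (hR : R < 1) :
    ‖((r : ℂ) * Complex.exp (Complex.I * φ)) ^ N /
      (((r : ℂ) * Complex.exp (Complex.I * φ)) ^ N - 1)‖ ≤ R ^ N / (1 - R) := by
  have h1 := norm_polar_pow N φ hr
  have h2 : r ^ N ≤ R ^ N := by gcongr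
  have h3 : R ^ N ≤ R := pow_le_of_le_one (hr.trans hrR) hR.le hN
  have h4 := norm_sub_norm_le (1 : ℂ) (((r : ℂ) * Complex.exp (Complex.I * φ)) ^ N)
  rw [norm_one, h1, norm_sub_rev] at h4
  have h5 : 0 < 1 - R := by linarith
  have h6 : 0 ≤ R ^ N := pow_nonneg (hr.trans hrR) N
  rw [norm_div, h1]
  gcongr
  linarith

lemma summable_two_pow_mul_pow {R : ℝ} (hR : 0 ≤ R) (hR1 : R < 1) :
    Summable fun n : ℕ => (2 : ℝ) ^ (n + 1) * R ^ (2 ^ (2 ^ (n + 1))) := by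
  have h := summable_pow_mul_geometric_of_norm_lt_one (R := ℝ) 1 (r := R)
    (by rwa [Real.norm_of_nonneg hR])
  have hinj : Function.Injective fun n : ℕ => 2 ^ (2 ^ (n + 1)) := fun m n hmn => by
    have := Nat.pow_right_injective le_rfl (Nat.pow_right_injective le_rfl hmn)
    omega
  refine (h.comp_injective hinj).of_nonneg_of_le (fun n => by positivity) fun n => ?_
  have : (2 : ℝ) ^ (n + 1) ≤ (2 ^ (2 ^ (n + 1)) : ℕ) := by
    exact_mod_cast (Nat.lt_two_pow_self (n := 2 ^ (n + 1))).le
  simp only [Function.comp_apply, pow_one]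
  gcongr

lemma hasSum_uNonOsc (φ : ℝ) {r : ℝ} (hr : 0 ≤ r) (hr1 : r < 1) :
    HasSum (fun n : ℕ => (2 : ℝ) ^ (n + 1) * reTerm (2 ^ (2 ^ (n + 1))) φ r)
      (uNonOsc ((r : ℂ) * Complex.exp (Complex.I * φ))) := by
  have hs : Summable fun n : ℕ => (2 : ℂ) ^ (n + 1) *
      ((r : ℂ) * Complex.exp (Complex.I * φ)) ^ (2 ^ (2 ^ (n + 1))) /
      (((r : ℂ) * Complex.exp (Complex.I * φ)) ^ (2 ^ (2 ^ (n + 1))) - 1) := by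
    refine Summable.of_norm_bounded ((summable_two_pow_mul_pow hr hr1).div_const (1 - r))
      fun n => ?_
    rw [mul_div_assoc, mul_div_assoc, norm_mul]
    have := norm_div_sub_one_le (N := 2 ^ (2 ^ (n + 1))) (by positivity) φ hr le_rfl hr1
    simp only [norm_pow, Complex.norm_ofNat]
    gcongr
  have h := Complex.hasSum_re hs.hasSum
  refine h.congr_fun ?_
  intro n
  rw [mul_div_assoc, reTerm]
  have : ((2 : ℂ) ^ (n + 1)) = (((2 : ℝ) ^ (n + 1) : ℝ) : ℂ) := by push_cast; rfl
  rw [this, Complex.re_ofReal_mul]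

lemma hasSum_Iu (φ : ℝ) {R : ℝ} (hR : 1 / 2 ≤ R) (hR1 : R < 1) :
    HasSum (fun n : ℕ => (2 : ℝ) ^ (n + 1) * ∫ r in (1 / 2 : ℝ)..R,
      reTerm (2 ^ (2 ^ (n + 1))) φ r / ((1 - r) * (Real.log (1 / (1 - r))) ^ 2))
      (Iu uNonOsc R φ) := by
  simp_rw [← intervalIntegral.integral_const_mul]
  unfold Iu
  have hsum : Summable fun n : ℕ =>
      (2 : ℝ) ^ (n + 1) * R ^ (2 ^ (2 ^ (n + 1))) * (1 / (1 - R) * (4 / (1 - R))) :=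
    (summable_two_pow_mul_pow (by linarith) hR1).mul_right _
  have hmem : ∀ r ∈ uIoc (1 / 2) R, r ∈ Icc (1 / 2) R := fun r hr => by
    rw [uIoc_of_le hR] at hr
    exact Ioc_subset_Icc_self hr
  refine intervalIntegral.hasSum_integral_of_dominated_convergence
    (fun n _ => (2 : ℝ) ^ (n + 1) * R ^ (2 ^ (2 ^ (n + 1))) * (1 / (1 - R) * (4 / (1 - R))))
    (fun n => ?_) (fun n => ?_) ?_ ?_ ?_
  · have := intervalIntegrable_div_weight le_rfl hR hR1
      (continuousOn_reTerm (N := 2 ^ (2 ^ (n + 1))) (by positivity) φ (by norm_num) hR1)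
    exact (intervalIntegrable_iff.1 (this.const_mul _)).aestronglyMeasurable
  · refine Eventually.of_forall fun r hr => ?_
    obtain ⟨hr0, hr2⟩ := hmem r hr
    have h1 := half_le_log_inv hr0 (hr2.trans_lt hR1)
    have h2 : 0 < 1 - R := by linarith
    have h3 : |reTerm (2 ^ (2 ^ (n + 1))) φ r| ≤ _ := (Complex.abs_re_le_norm _).trans
      (norm_div_sub_one_le (N := 2 ^ (2 ^ (n + 1))) (by positivity) φ (by linarith) hr2 hR1)
    have h4 : (1 - R) / 4 ≤ (1 - r) * (Real.log (1 / (1 - r))) ^ 2 := by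
      have : (1 / 2 : ℝ) ^ 2 ≤ (Real.log (1 / (1 - r))) ^ 2 := by gcongr
      nlinarith
    rw [norm_mul, norm_div, Real.norm_eq_abs (reTerm _ _ _), Real.norm_of_nonneg (by positivity),
      Real.norm_of_nonneg (by linarith : 0 ≤ (1 - r) * (Real.log (1 / (1 - r))) ^ 2)]
    calc _ ≤ (2 : ℝ) ^ (n + 1) * (R ^ (2 ^ (2 ^ (n + 1))) / (1 - R) / ((1 - R) / 4)) := by
          gcongr
      _ = _ := by field_simp
  · exact Eventually.of_forall fun r _ => hsum
  · exact intervalIntegrable_const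
  · refine Eventually.of_forall fun r hr => ?_
    obtain ⟨hr0, hr2⟩ := hmem r hr
    have := (hasSum_uNonOsc φ (by linarith) (hr2.trans_lt hR1)).div_const
      ((1 - r) * (Real.log (1 / (1 - r))) ^ 2)
    simpa only [mul_div_assoc] using this

/-- The contribution of the `n`-th term to `I_u(R, φ)`, up to a summable error,
where `X = log (1 / (1 - R))`. -/
noncomputable def mainTerm (X : ℝ) (n : ℕ) : ℝ :=
  2 ^ (n + 1) * max 0 (1 / 2 * (1 / (2 ^ (n + 1) * Real.log 2) - 1 / X))

lemma hasSum_mainTerm {X : ℝ} {k : ℕ} (hk : 2 ^ k * Real.log 2 ≤ X)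
    (hk' : X < 2 ^ (k + 1) * Real.log 2) :
    HasSum (mainTerm X) (k / (2 * Real.log 2) - (2 ^ k - 1) / X) := by
  have hl : 0 < Real.log 2 := Real.log_pos (by norm_num)
  have hX : 0 < X := lt_of_lt_of_le (by positivity) hk
  have hzero : ∀ n ∉ Finset.range k, mainTerm X n = 0 := fun n hn => by
    rw [Finset.mem_range, not_lt] at hn
    have h1 : X ≤ 2 ^ (n + 1) * Real.log 2 := hk'.le.trans (by gcongr; norm_num)
    have h2 : 1 / (2 ^ (n + 1) * Real.log 2) ≤ 1 / X := by gcongr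
    rw [mainTerm, max_eq_left (by linarith), mul_zero]
  have hval : ∀ n ∈ Finset.range k, mainTerm X n = 1 / (2 * Real.log 2) - 2 ^ n / X :=
    fun n hn => by
    rw [Finset.mem_range] at hn
    have h1 : 2 ^ (n + 1) * Real.log 2 ≤ X := le_trans (by gcongr; norm_num; omega) hk
    have h2 : 1 / X ≤ 1 / (2 ^ (n + 1) * Real.log 2) := by gcongr
    rw [mainTerm, max_eq_right (by linarith), pow_succ]
    field_simp
  have hgeom : ∑ n ∈ Finset.range k, (2 : ℝ) ^ n = 2 ^ k - 1 := by
    rw [geom_sum_eq (by norm_num)]; norm_num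
  have h : HasSum (mainTerm X) _ := hasSum_sum_of_ne_finset_zero hzero
  rw [Finset.sum_congr rfl hval, Finset.sum_sub_distrib, ← Finset.sum_div _ _ X, hgeom] at h
  simpa [div_eq_mul_inv] using h

lemma mainTerm_sum_bounds {X : ℝ} (hX : Real.log 2 ≤ X) :
    ∃ S, HasSum (mainTerm X) S ∧ Real.log X / 2 - 5 / 2 ≤ S ∧ S ≤ 2 * Real.log X + 2 := by
  have hl1 := Real.log_two_gt_d9
  have hl2 := Real.log_two_lt_d9
  have hl : 0 < Real.log 2 := by linarith
  obtain ⟨k, hk, hk'⟩ := exists_nat_pow_near (x := X / Real.log 2) (y := 2)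
    ((one_le_div hl).2 hX) (by norm_num)
  rw [le_div_iff₀ hl] at hk
  rw [div_lt_iff₀ hl] at hk'
  have hX0 : 0 < X := by linarith
  refine ⟨_, hasSum_mainTerm hk hk', ?_, ?_⟩
  · have h1 : Real.log X ≤ (k + 1 : ℕ) * Real.log 2 := by
      rw [← Real.log_pow]
      refine Real.log_le_log hX0 (hk'.le.trans ?_)
      exact mul_le_of_le_one_right (by positivity) (by linarith)
    have h2 : (2 ^ k - 1) / X ≤ 2 := by
      rw [div_le_iff₀ hX0]
      nlinarith [pow_pos (two_pos : (0 : ℝ) < 2) k]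
    have h3 : (k : ℝ) / 2 ≤ k / (2 * Real.log 2) := by gcongr; linarith
    push_cast at h1
    have hk0 : (0 : ℝ) ≤ k := k.cast_nonneg
    nlinarith
  · have h1 : k * Real.log 2 - Real.log 2 ≤ Real.log X := by
      have h0 : (2 : ℝ) ^ k / 2 ≤ X :=
        le_trans (by rw [div_eq_mul_inv]; gcongr; linarith) hk
      have := Real.log_le_log (by positivity) h0
      rwa [Real.log_div (by positivity) (by norm_num), Real.log_pow] at this
    have h2 : 0 ≤ (2 ^ k - 1) / X :=
      div_nonneg (sub_nonneg.2 (one_le_pow₀ (by norm_num))) hX0.le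
    have h3 : (k : ℝ) / (2 * Real.log 2) ≤ k := by
      apply div_le_self k.cast_nonneg; linarith
    have hk0 : (0 : ℝ) ≤ k := k.cast_nonneg
    nlinarith

lemma exists_abs_Iu_sub_le {φ : ℝ} {D : ℕ → ℝ} (hD : ∀ n, 1 ≤ D n)
    (hcos : ∀ n, Real.cos (Nn (n + 1) * φ) ≤ 1 - 1 / D n)
    (hsum : Summable fun n => D n / 2 ^ (n + 1)) :
    ∃ C, ∀ R S, 1 / 2 ≤ R → R < 1 → HasSum (mainTerm (Real.log (1 / (1 - R)))) S →
      |Iu uNonOsc R φ - S| ≤ C := by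
  have hl : 0 < Real.log 2 := Real.log_pos (by norm_num)
  refine ⟨∑' n, D n / 2 ^ (n + 1) * (2048 * π / Real.log 2 ^ 2), fun R S hR hR1 hS => ?_⟩
  have h := (hasSum_Iu φ hR hR1).sub hS
  rw [← Real.norm_eq_abs]
  refine h.norm_le_of_bounded (hsum.mul_right _).hasSum fun n => ?_
  have hNat : ((2 ^ (2 ^ (n + 1)) : ℕ) : ℝ) = Nn (n + 1) := by simp [Nn]
  have hD0 : 0 < D n := by linarith [hD n]
  have h1 := abs_integral_reTerm_sub_le (N := 2 ^ (2 ^ (n + 1))) (φ := φ) (δ := 1 / D n)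
    (Nat.le_self_pow (by positivity) 2) (by positivity)
    ((div_le_one hD0).2 (hD n)) (by rw [hNat]; exact hcos n) hR hR1
  have hlog : Real.log ((2 ^ (2 ^ (n + 1)) : ℕ) : ℝ) = 2 ^ (n + 1) * Real.log 2 := by
    push_cast; rw [Real.log_pow]; push_cast; rfl
  rw [hlog] at h1
  rw [mainTerm, ← mul_sub, norm_mul, Real.norm_of_nonneg (by positivity), Real.norm_eq_abs]
  calc _ ≤ (2 : ℝ) ^ (n + 1) * (2048 * π / (1 / D n * (2 ^ (n + 1) * Real.log 2) ^ 2)) := by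
        gcongr
    _ = _ := by field_simp

lemma exists_cos_le_of_notMem {a φ : ℝ} (hφ : φ ∈ Ioc (-π) π) (h : φ ∉ Fbad a) :
    ∃ D : ℕ → ℝ, (∀ n, 1 ≤ D n) ∧ (∀ n, Real.cos (Nn (n + 1) * φ) ≤ 1 - 1 / D n) ∧
      Summable fun n => D n / 2 ^ (n + 1) := by
  simp only [Fbad, Fm, mem_iInter, mem_union, mem_iUnion, not_forall, not_or, not_exists] at h
  obtain ⟨m, -, hE, hEm⟩ := h
  have hNm : 1 ≤ Nn m := one_le_pow₀ (by norm_num)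
  refine ⟨fun n => ((n + 1 : ℕ) : ℝ) ^ ⌈a⌉₊ + Nn m, fun n => ?_, fun n => ?_, ?_⟩
  · have : (0 : ℝ) ≤ ((n + 1 : ℕ) : ℝ) ^ ⌈a⌉₊ := by positivity
    linarith
  · have hpos : (0 : ℝ) < ((n + 1 : ℕ) : ℝ) ^ ⌈a⌉₊ := by positivity
    rcases le_or_gt m (n + 1) with hm | hm
    · have h1 := hE (n + 1) hm
      simp only [En, mem_ofPred_eq, not_and, not_lt] at h1
      have h2 : ((n + 1 : ℕ) : ℝ) ^ a ≤ ((n + 1 : ℕ) : ℝ) ^ ⌈a⌉₊ := by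
        rw [← Real.rpow_natCast]
        exact Real.rpow_le_rpow_of_exponent_le (by push_cast; linarith [n.cast_nonneg (α := ℝ)])
          (Nat.le_ceil a)
      have h3 : 1 / (((n + 1 : ℕ) : ℝ) ^ ⌈a⌉₊ + Nn m) ≤ ((n + 1 : ℕ) : ℝ) ^ (-a) := by
        rw [Real.rpow_neg (by positivity), one_div]
        have : (0 : ℝ) < ((n + 1 : ℕ) : ℝ) ^ a := by positivity
        gcongr
        linarith
      linarith [h1 hφ]
    · have h1 := hEm (n + 1) ⟨by omega, hm⟩
      simp only [Enm, mem_ofPred_eq, not_and, not_lt] at h1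
      have h3 : 1 / (((n + 1 : ℕ) : ℝ) ^ ⌈a⌉₊ + Nn m) ≤ (Nn m)⁻¹ := by
        rw [one_div]
        gcongr
        linarith
      linarith [h1 hφ]
  · have h1 := summable_pow_mul_geometric_of_norm_lt_one (R := ℝ) ⌈a⌉₊ (r := 1 / 2)
      (by norm_num)
    have h2 := (summable_geometric_two).mul_left (Nn m)
    refine ((summable_nat_add_iff 1).2 (h1.add h2)).congr fun n => ?_
    rw [one_div, inv_pow]
    ring

lemma tendsto_log_log_inv :
    Tendsto (fun R : ℝ => Real.log (Real.log (1 / (1 - R)))) (nhdsWithin 1 (Iio 1)) atTop := by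
  refine Real.tendsto_log_atTop.comp (Real.tendsto_log_atTop.comp ?_)
  simp_rw [one_div]
  refine tendsto_inv_nhdsGT_zero.comp (tendsto_nhdsWithin_iff.2 ⟨?_, ?_⟩)
  · have : Tendsto (fun R : ℝ => 1 - R) (nhds 1) (nhds (1 - 1)) :=
      (continuous_const.sub continuous_id).tendsto 1
    rw [sub_self] at this
    exact this.mono_left nhdsWithin_le_nhds
  · filter_upwards [self_mem_nhdsWithin] with R hR
    exact sub_pos.2 (mem_Iio.1 hR)

theorem stmt_11 (a : ℝ) (ha : 2 < a) :
    ∀ φ ∈ Ioc (-π) π, φ ∉ Fbad a →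
      0 < Filter.liminf
        (fun R : ℝ => Iu uNonOsc R φ / Real.log (Real.log (1 / (1 - R))))
        (nhdsWithin 1 (Iio 1)) := by
  intro φ hφ hF
  obtain ⟨D, hD, hcos, hsum⟩ := exists_cos_le_of_notMem hφ hF
  obtain ⟨C, hC⟩ := exists_abs_Iu_sub_le hD hcos hsum
  have hbounds : ∀ᶠ R in nhdsWithin (1 : ℝ) (Iio 1),
      1 / 4 ≤ Iu uNonOsc R φ / Real.log (Real.log (1 / (1 - R))) ∧
      Iu uNonOsc R φ / Real.log (Real.log (1 / (1 - R))) ≤ 3 := by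
    filter_upwards [self_mem_nhdsWithin,
      mem_nhdsWithin_of_mem_nhds (Ioi_mem_nhds (by norm_num : (1 / 2 : ℝ) < 1)),
      tendsto_log_log_inv.eventually_ge_atTop (1 + 4 * (5 / 2 + |C|))] with R hR1 hR2 hT
    rw [mem_Iio] at hR1
    rw [mem_Ioi] at hR2
    have hX : Real.log 2 ≤ Real.log (1 / (1 - R)) := by
      apply Real.log_le_log (by norm_num)
      rw [le_div_iff₀ (by linarith)]; linarith
    obtain ⟨S, hS, hS1, hS2⟩ := mainTerm_sum_bounds hX
    have h := abs_le.1 (hC R S hR2.le hR1 hS)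
    have hC' := le_abs_self C
    have hC0 := abs_nonneg C
    set T := Real.log (Real.log (1 / (1 - R)))
    have hT0 : 0 < T := by linarith
    rw [le_div_iff₀ hT0, div_le_iff₀ hT0]
    constructor <;> linarith [h.1, h.2]
  have hub : Filter.IsBoundedUnder (· ≤ ·) (nhdsWithin (1 : ℝ) (Iio 1))
      (fun R : ℝ => Iu uNonOsc R φ / Real.log (Real.log (1 / (1 - R)))) :=
    isBoundedUnder_of_eventually_le (hbounds.mono fun _ h => h.2)
  exact lt_of_lt_of_le (by norm_num : (0 : ℝ) < 1 / 4)
    (le_liminf_of_le hub.isCoboundedUnder_ge (hbounds.mono fun _ h => h.1))
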